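/- For each n, consider the move-to-front scheme on n cards with card probabilities p_j = 2(n+1−j) / (n(n+1)) for 1 ≤ j ≤ n. Then the mixing time is Θ(n²): there exist constants c_1, c_2 > 0 and N such that for all n ≥ N, c_1 · n² ≤ τ_mix(n) ≤ c_2 · n². -/

import Mathlib

open Finset

/-- Total variation distance between two distributions on a finite set. -/
noncomputable def tvDist {S : Type*} [Fintype S] (μ ν : S → ℝ) : ℝ :=
  (1/2) * ∑ s, |μ s - ν s|

/-- Point mass at `s0`. -/
noncomputable def dirac {S : Type*} [DecidableEq S] (s0 : S) : S → ℝ :=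
  fun s => if s = s0 then 1 else 0

/-- Distribution of the chain with transition matrix `P` after `t` steps, started from `μ`. -/
noncomputable def evolve {S : Type*} [Fintype S] (P : S → S → ℝ) (μ : S → ℝ) : ℕ → S → ℝ
  | 0 => μ
  | t+1 => fun s' => ∑ s, evolve P μ t s * P s s'

/-- Mixing time: the worst case over starting states of the first time the
total variation distance to `π` drops to `1/4`. -/
noncomputable def mixTime {S : Type*} [Fintype S] [DecidableEq S]
    (P : S → S → ℝ) (π : S → ℝ) : ℕ :=
  Finset.univ.sup fun s0 => sInf {t : ℕ | tvDist (evolve P (dirac s0) t) π ≤ 1/4}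

/-- Transition matrix of the move-to-front scheme on `n` cards with card
probabilities `p`.  A state `σ` records the position `σ c` (with `0` the top) of
each card `c`; moving card `j` to the top turns `σ` into `Fin.cycleRange (σ j) * σ`. -/
noncomputable def mtfP (n : ℕ) (p : Fin n → ℝ) (σ σ' : Equiv.Perm (Fin n)) : ℝ :=
  ∑ j, if Fin.cycleRange (σ j) * σ = σ' then p j else 0

/-- The state obtained from `σ` by moving card `j` to the top. -/
def moveToFront {n : ℕ} (σ : Equiv.Perm (Fin n)) (j : Fin n) : Equiv.Perm (Fin n) :=
  Fin.cycleRange (σ j) * σ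

/-- The transition operator of the move-to-front scheme, acting on functions. -/
noncomputable def mtfOp {n : ℕ} (p : Fin n → ℝ) (f : Equiv.Perm (Fin n) → ℝ)
    (σ : Equiv.Perm (Fin n)) : ℝ :=
  ∑ j, p j * f (moveToFront σ j)

lemma val_moveToFront {n : ℕ} (σ : Equiv.Perm (Fin n)) (j c : Fin n) :
    (moveToFront σ j c : ℕ) =
      if σ c < σ j then (σ c : ℕ) + 1 else if c = j then 0 else (σ c : ℕ) := by
  have : NeZero n := ⟨(Nat.zero_lt_of_lt j.isLt).ne'⟩
  rw [moveToFront, Equiv.Perm.mul_apply]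
  rcases lt_trichotomy (σ c) (σ j) with h | h | h
  · simp [h, Fin.coe_cycleRange_of_lt h]
  · have hcj : c = j := σ.injective h
    subst hcj
    simp
  · have hcj : c ≠ j := by rintro rfl; exact lt_irrefl _ h
    simp [Fin.cycleRange_of_gt h, h.not_gt, hcj]

lemma moveToFront_self_lt {n : ℕ} (σ : Equiv.Perm (Fin n)) {j d : Fin n} (h : d ≠ j) :
    moveToFront σ j j < moveToFront σ j d := by
  have hne : σ d ≠ σ j := fun e => h (σ.injective e)
  rw [Fin.lt_def, val_moveToFront, val_moveToFront]
  grind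

lemma moveToFront_lt_iff {n : ℕ} (σ : Equiv.Perm (Fin n)) {j c d : Fin n}
    (hc : c ≠ j) (hd : d ≠ j) :
    moveToFront σ j c < moveToFront σ j d ↔ σ c < σ d := by
  have hcj : σ c ≠ σ j := fun e => hc (σ.injective e)
  have hdj : σ d ≠ σ j := fun e => hd (σ.injective e)
  rw [Fin.lt_def, val_moveToFront, val_moveToFront]
  grind

/-- The cards of `A` occupy the top positions in both `σ` and `σ'`, in the same order. -/
def AgreeOnTop {n : ℕ} (A : Finset (Fin n)) (σ σ' : Equiv.Perm (Fin n)) : Prop :=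
  (∀ c ∈ A, σ c = σ' c) ∧ ∀ c ∈ A, ∀ d ∉ A, σ c < σ d ∧ σ' c < σ' d

lemma AgreeOnTop.moveToFront {n : ℕ} {A : Finset (Fin n)} {σ σ' : Equiv.Perm (Fin n)}
    (h : AgreeOnTop A σ σ') (j : Fin n) :
    AgreeOnTop (insert j A) (moveToFront σ j) (moveToFront σ' j) := by
  obtain ⟨h₁, h₂⟩ := h
  refine ⟨fun c hc => ?_, fun c hc d hd => ?_⟩
  · apply Fin.ext
    rw [val_moveToFront, val_moveToFront]
    by_cases hcj : c = j
    · subst hcj; simp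
    have hcA : c ∈ A := (mem_insert.1 hc).resolve_left hcj
    by_cases hjA : j ∈ A
    · rw [h₁ c hcA, h₁ j hjA]
    · rw [if_pos (h₂ c hcA j hjA).1, if_pos (h₂ c hcA j hjA).2, h₁ c hcA]
  · rw [mem_insert, not_or] at hd
    by_cases hcj : c = j
    · subst hcj
      exact ⟨moveToFront_self_lt σ hd.1, moveToFront_self_lt σ' hd.1⟩
    have hcA : c ∈ A := (mem_insert.1 hc).resolve_left hcj
    rw [moveToFront_lt_iff σ hcj hd.1, moveToFront_lt_iff σ' hcj hd.1]
    exact h₂ c hcA d hd.2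

lemma sum_mul_mtfP {n : ℕ} (p : Fin n → ℝ) (μ f : Equiv.Perm (Fin n) → ℝ) :
    ∑ s', (∑ s, μ s * mtfP n p s s') * f s' = ∑ s, μ s * mtfOp p f s := by
  simp_rw [sum_mul]
  rw [sum_comm]
  refine sum_congr rfl fun s _ => ?_
  simp_rw [mul_assoc, ← mul_sum, mtfP, sum_mul]
  rw [sum_comm]
  simp [mtfOp, _root_.moveToFront]

lemma sum_evolve_mtfP_mul {n : ℕ} (p : Fin n → ℝ) (μ : Equiv.Perm (Fin n) → ℝ) (t : ℕ)
    (f : Equiv.Perm (Fin n) → ℝ) :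
    ∑ s, evolve (mtfP n p) μ t s * f s = ∑ s, μ s * (mtfOp p)^[t] f s := by
  induction t generalizing f with
  | zero => rfl
  | succ t ih =>
    rw [Function.iterate_succ_apply, ← ih]
    exact sum_mul_mtfP p _ f

lemma sum_dirac_mul {S : Type*} [Fintype S] [DecidableEq S] (s₀ : S) (f : S → ℝ) :
    ∑ s, dirac s₀ s * f s = f s₀ := by
  simp [dirac]

lemma sum_mul_iterate_mtfOp {n : ℕ} {p : Fin n → ℝ} {π : Equiv.Perm (Fin n) → ℝ}
    (hπ : ∀ s', ∑ s, π s * mtfP n p s s' = π s') (t : ℕ) (f : Equiv.Perm (Fin n) → ℝ) :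
    ∑ s, π s * (mtfOp p)^[t] f s = ∑ s, π s * f s := by
  induction t generalizing f with
  | zero => rfl
  | succ t ih => rw [Function.iterate_succ_apply, ih, ← sum_mul_mtfP]; simp_rw [hπ]

/-- Two states whose top cards agree are coupled as soon as all other cards were chosen. -/
lemma AgreeOnTop.abs_iterate_mtfOp_sub_le {n : ℕ} {p : Fin n → ℝ} (hp : ∀ j, 0 ≤ p j)
    (hp₁ : ∑ j, p j = 1) {f : Equiv.Perm (Fin n) → ℝ} (hf : ∀ s, |f s| ≤ 1) (t : ℕ)
    {A : Finset (Fin n)} {σ σ' : Equiv.Perm (Fin n)} (h : AgreeOnTop A σ σ') :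
    |(mtfOp p)^[t] f σ - (mtfOp p)^[t] f σ'| ≤ 2 * ∑ i ∈ Aᶜ, (1 - p i) ^ t := by
  induction t generalizing A σ σ' with
  | zero =>
    by_cases hA : A = univ
    · have : σ = σ' := Equiv.ext fun c => h.1 c (hA ▸ mem_univ c)
      simp [this, hA]
    · have hcard : (1 : ℝ) ≤ #Aᶜ := by
        exact_mod_cast card_pos.2 (nonempty_iff_ne_empty.2 (by simpa using hA))
      have h₁ := abs_sub (f σ) (f σ')
      simp only [Function.iterate_zero, id, pow_zero, sum_const, nsmul_eq_mul, mul_one]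
      linarith [hf σ, hf σ']
  | succ t ih =>
    simp_rw [Function.iterate_succ_apply']
    calc |mtfOp p ((mtfOp p)^[t] f) σ - mtfOp p ((mtfOp p)^[t] f) σ'|
        = |∑ j, p j * ((mtfOp p)^[t] f (_root_.moveToFront σ j)
            - (mtfOp p)^[t] f (_root_.moveToFront σ' j))| := by
          simp only [mtfOp, mul_sub, sum_sub_distrib]
      _ ≤ ∑ j, p j * (2 * ∑ i ∈ (insert j A)ᶜ, (1 - p i) ^ t) := by
          refine (abs_sum_le_sum_abs _ _).trans (sum_le_sum fun j _ => ?_)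
          rw [abs_mul, abs_of_nonneg (hp j)]
          exact mul_le_mul_of_nonneg_left (ih (h.moveToFront j)) (hp j)
      _ = ∑ j, ∑ i ∈ Aᶜ, if i = j then 0 else 2 * (p j * (1 - p i) ^ t) := by
          refine sum_congr rfl fun j _ => ?_
          rw [compl_insert, ← filter_ne', sum_filter, mul_sum, mul_sum]
          refine sum_congr rfl fun i _ => ?_
          by_cases hij : i = j <;> simp [hij]; ring
      _ = ∑ i ∈ Aᶜ, 2 * (1 - p i) ^ (t + 1) := by
          rw [sum_comm]
          refine sum_congr rfl fun i _ => ?_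
          have hsub : ∀ j, (if i = j then 0 else 2 * (p j * (1 - p i) ^ t))
              = 2 * (1 - p i) ^ t * (p j - if i = j then p j else 0) := fun j => by
            split_ifs <;> ring
          simp_rw [hsub]
          rw [← mul_sum, sum_sub_distrib, hp₁, sum_ite_eq, if_pos (mem_univ i)]
          ring
      _ = 2 * ∑ i ∈ Aᶜ, (1 - p i) ^ (t + 1) := (mul_sum _ _ _).symm

lemma tvDist_evolve_mtfP_le {n : ℕ} {p : Fin n → ℝ} (hp : ∀ j, 0 ≤ p j)
    (hp₁ : ∑ j, p j = 1) {π : Equiv.Perm (Fin n) → ℝ} (hπ₀ : ∀ s, 0 ≤ π s)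
    (hπ₁ : ∑ s, π s = 1) (hπ : ∀ s', ∑ s, π s * mtfP n p s s' = π s')
    (s₀ : Equiv.Perm (Fin n)) (t : ℕ) :
    tvDist (evolve (mtfP n p) (dirac s₀) t) π ≤ ∑ i, (1 - p i) ^ t := by
  set μ := evolve (mtfP n p) (dirac s₀) t with hμ
  let f : Equiv.Perm (Fin n) → ℝ := fun s => if 0 ≤ μ s - π s then 1 else -1
  have hf : ∀ s, |f s| ≤ 1 := fun s => by
    simp only [f]; split_ifs <;> simp
  have habs : ∀ s, |μ s - π s| = μ s * f s - π s * f s := fun s => by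
    simp only [f]
    split_ifs with h
    · rw [abs_of_nonneg h]; ring
    · rw [abs_of_neg (not_le.1 h)]; ring
  have key : ∑ s, |μ s - π s|
      = ∑ s, π s * ((mtfOp p)^[t] f s₀ - (mtfOp p)^[t] f s) := by
    simp_rw [habs, mul_sub, sum_sub_distrib]
    rw [← sum_mul, hπ₁, one_mul, sum_mul_iterate_mtfOp hπ, hμ, sum_evolve_mtfP_mul,
      sum_dirac_mul]
  have hbound : ∑ s, |μ s - π s| ≤ ∑ s, π s * (2 * ∑ i, (1 - p i) ^ t) := by
    rw [key]
    refine sum_le_sum fun s _ => mul_le_mul_of_nonneg_left ?_ (hπ₀ s)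
    have h : AgreeOnTop ∅ s₀ s := by simp [AgreeOnTop]
    simpa using (le_abs_self _).trans (h.abs_iterate_mtfOp_sub_le hp hp₁ hf t)
  rw [← sum_mul, hπ₁] at hbound
  rw [tvDist]
  linarith

/-- The indicator function of the states in which card `a` lies above card `b`. -/
def aboveIndicator {n : ℕ} (a b : Fin n) (σ : Equiv.Perm (Fin n)) : ℝ :=
  if σ a < σ b then 1 else 0

lemma mtfOp_aboveIndicator {n : ℕ} {p : Fin n → ℝ} (hp₁ : ∑ j, p j = 1) {a b : Fin n}
    (hab : a ≠ b) (σ : Equiv.Perm (Fin n)) :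
    mtfOp p (aboveIndicator a b) σ
      = (1 - p a - p b) * aboveIndicator a b σ + p a := by
  have hmove : ∀ j, p j * aboveIndicator a b (moveToFront σ j)
      = p j * aboveIndicator a b σ + (if j = a then p j * (1 - aboveIndicator a b σ) else 0)
        - if j = b then p j * aboveIndicator a b σ else 0 := by
    intro j
    by_cases hja : j = a
    · subst hja
      simp only [aboveIndicator, moveToFront_self_lt σ hab.symm, hab, if_true, if_false]
      ring
    by_cases hjb : j = b
    · subst hjb
      simp [aboveIndicator, (moveToFront_self_lt σ hab).not_gt, hja]
    · simp [aboveIndicator, moveToFront_lt_iff σ (Ne.symm hja) (Ne.symm hjb), hja, hjb]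
  simp_rw [mtfOp, hmove]
  rw [sum_sub_distrib, sum_add_distrib, ← sum_mul, hp₁, sum_ite_eq', sum_ite_eq',
    if_pos (mem_univ _), if_pos (mem_univ _)]
  ring

lemma iterate_mtfOp_aboveIndicator {n : ℕ} {p : Fin n → ℝ} (hp₁ : ∑ j, p j = 1)
    {a b : Fin n} (hab : a ≠ b) (hpos : 0 < p a + p b) (t : ℕ) (σ : Equiv.Perm (Fin n)) :
    (mtfOp p)^[t] (aboveIndicator a b) σ
      = p a / (p a + p b)
        + (1 - p a - p b) ^ t * (aboveIndicator a b σ - p a / (p a + p b)) := by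
  induction t generalizing σ with
  | zero => simp
  | succ t ih =>
    have hlin : mtfOp p ((mtfOp p)^[t] (aboveIndicator a b)) σ
        = p a / (p a + p b) + (1 - p a - p b) ^ t
          * (mtfOp p (aboveIndicator a b) σ - p a / (p a + p b)) := by
      have : ∀ j, p j * (mtfOp p)^[t] (aboveIndicator a b) (moveToFront σ j)
          = p j * (p a / (p a + p b) - (1 - p a - p b) ^ t * (p a / (p a + p b)))
            + (1 - p a - p b) ^ t * (p j * aboveIndicator a b (moveToFront σ j)) := fun j => by
        rw [ih]; ring
      rw [mtfOp]
      simp_rw [this]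
      rw [sum_add_distrib, ← sum_mul, hp₁, ← mul_sum, ← mtfOp]
      ring
    rw [Function.iterate_succ_apply', hlin, mtfOp_aboveIndicator hp₁ hab]
    field_simp
    ring

lemma sum_stationary_mul_aboveIndicator {n : ℕ} {p : Fin n → ℝ} (hp₁ : ∑ j, p j = 1)
    {π : Equiv.Perm (Fin n) → ℝ} (hπ₁ : ∑ s, π s = 1)
    (hπ : ∀ s', ∑ s, π s * mtfP n p s s' = π s') {a b : Fin n} (hab : a ≠ b)
    (hpos : 0 < p a + p b) :
    ∑ s, π s * aboveIndicator a b s = p a / (p a + p b) := by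
  have h := sum_mul_iterate_mtfOp hπ 1 (aboveIndicator a b)
  simp_rw [Function.iterate_one, mtfOp_aboveIndicator hp₁ hab, mul_add, sum_add_distrib,
    ← sum_mul, hπ₁, mul_left_comm (π _), ← mul_sum] at h
  rw [eq_div_iff hpos.ne']
  linarith

lemma sum_mul_sub_sum_mul_le_tvDist {S : Type*} [Fintype S] {μ ν f : S → ℝ}
    (hf₀ : ∀ s, 0 ≤ f s) (hf₁ : ∀ s, f s ≤ 1) (h : ∑ s, μ s = ∑ s, ν s) :
    ∑ s, μ s * f s - ∑ s, ν s * f s ≤ tvDist μ ν := by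
  have h₁ : ∑ s, (μ s - ν s) * (f s - 1 / 2) = ∑ s, μ s * f s - ∑ s, ν s * f s := by
    simp_rw [mul_sub, sub_mul, sum_sub_distrib, ← sum_mul, h]
    ring
  rw [← h₁, tvDist, mul_sum]
  refine sum_le_sum fun s _ => (le_abs_self _).trans ?_
  rw [abs_mul, mul_comm]
  refine mul_le_mul_of_nonneg_right (abs_le.2 ?_) (abs_nonneg _)
  constructor <;> linarith [hf₀ s, hf₁ s]

lemma sum_evolve_mtfP_dirac {n : ℕ} {p : Fin n → ℝ} (hp₁ : ∑ j, p j = 1)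
    (s₀ : Equiv.Perm (Fin n)) (t : ℕ) : ∑ s, evolve (mtfP n p) (dirac s₀) t s = 1 := by
  have h : mtfOp p (fun _ => 1) = fun _ => 1 := by
    ext; simp [mtfOp, hp₁]
  have := sum_evolve_mtfP_mul p (dirac s₀) t fun _ => 1
  rw [Function.iterate_fixed h, sum_dirac_mul] at this
  simpa using this

lemma le_tvDist_evolve_mtfP {n : ℕ} {p : Fin n → ℝ} (hp₁ : ∑ j, p j = 1)
    {π : Equiv.Perm (Fin n) → ℝ} (hπ₁ : ∑ s, π s = 1)
    (hπ : ∀ s', ∑ s, π s * mtfP n p s s' = π s') {a b : Fin n} (hab : a ≠ b)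
    (hpos : 0 < p a + p b) {s₀ : Equiv.Perm (Fin n)} (hs₀ : s₀ a < s₀ b) (t : ℕ) :
    (1 - p a - p b) ^ t * (1 - p a / (p a + p b))
      ≤ tvDist (evolve (mtfP n p) (dirac s₀) t) π := by
  have h := sum_mul_sub_sum_mul_le_tvDist (f := aboveIndicator a b)
    (fun s => by unfold aboveIndicator; split_ifs <;> simp)
    (fun s => by unfold aboveIndicator; split_ifs <;> simp)
    ((sum_evolve_mtfP_dirac hp₁ s₀ t).trans hπ₁.symm)
  rw [sum_evolve_mtfP_mul, sum_dirac_mul, iterate_mtfOp_aboveIndicator hp₁ hab hpos,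
    sum_stationary_mul_aboveIndicator hp₁ hπ₁ hπ hab hpos, aboveIndicator, if_pos hs₀] at h
  linarith

lemma mtf_linear_nonneg (n : ℕ) (j : Fin n) :
    0 ≤ 2 * ((n : ℝ) - (j : ℕ)) / ((n : ℝ) * ((n : ℝ) + 1)) := by
  have : ((j : ℕ) : ℝ) ≤ n := by exact_mod_cast j.isLt.le
  have : (0 : ℝ) ≤ n - (j : ℕ) := sub_nonneg.2 this
  positivity

lemma sum_mtf_linear {n : ℕ} (hn : n ≠ 0) :
    ∑ j : Fin n, 2 * ((n : ℝ) - (j : ℕ)) / ((n : ℝ) * ((n : ℝ) + 1)) = 1 := by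
  have h : ∀ m : ℕ, ∑ i ∈ range m, 2 * ((n : ℝ) - i) = 2 * n * m - m * (m - 1) := by
    intro m
    induction m with
    | zero => simp
    | succ m ih => rw [sum_range_succ, ih]; push_cast; ring
  have hn' : (n : ℝ) ≠ 0 := by exact_mod_cast hn
  rw [← sum_div, Fin.sum_univ_eq_sum_range fun i => 2 * ((n : ℝ) - i), h,
    div_eq_one_iff_eq (by positivity)]
  ring

lemma sum_one_sub_mtf_linear_pow_le {n : ℕ} (hn : n ≠ 0) :
    ∑ j : Fin n, (1 - 2 * ((n : ℝ) - (j : ℕ)) / ((n : ℝ) * ((n : ℝ) + 1))) ^ (2 * n ^ 2)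
      ≤ 1 / 4 := by
  have hn₁ : (1 : ℝ) ≤ n := by exact_mod_cast Nat.one_le_iff_ne_zero.2 hn
  have hexp : Real.exp (-2) ≤ 1 / 5 := by
    rw [Real.exp_neg, ← one_div]
    refine one_div_le_one_div_of_le (by norm_num) ?_
    have h := Real.exp_one_gt_d9
    rw [show (2 : ℝ) = 1 + 1 by norm_num, Real.exp_add]
    nlinarith
  have hterm : ∀ j : Fin n,
      (1 - 2 * ((n : ℝ) - (j : ℕ)) / ((n : ℝ) * ((n : ℝ) + 1))) ^ (2 * n ^ 2)
        ≤ (1 / 5) ^ ((Fin.rev j : ℕ) + 1) := by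
    intro j
    set q := 2 * ((n : ℝ) - (j : ℕ)) / ((n : ℝ) * ((n : ℝ) + 1)) with hq
    have hq₁ : q ≤ 1 := by
      rw [← sum_mtf_linear hn]
      exact single_le_sum (f := fun j : Fin n =>
        2 * ((n : ℝ) - (j : ℕ)) / ((n : ℝ) * ((n : ℝ) + 1)))
        (fun i _ => mtf_linear_nonneg n i) (mem_univ j)
    have hrev : (((Fin.rev j : ℕ) + 1 : ℕ) : ℝ) = n - (j : ℕ) := by
      rw [Fin.val_rev, show n - ((j : ℕ) + 1) + 1 = n - j by omega, Nat.cast_sub j.isLt.le]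
    have hk : (0 : ℝ) ≤ n - (j : ℕ) := by rw [← hrev]; positivity
    calc (1 - q) ^ (2 * n ^ 2) ≤ Real.exp (-q) ^ (2 * n ^ 2) :=
          pow_le_pow_left₀ (by linarith) (Real.one_sub_le_exp_neg q) _
      _ = Real.exp (-(q * (2 * n ^ 2))) := by
          rw [← Real.exp_nat_mul]; push_cast; ring_nf
      _ ≤ Real.exp (-(2 * ((Fin.rev j : ℕ) + 1 : ℕ))) := by
          refine Real.exp_le_exp.2 (neg_le_neg ?_)
          rw [hrev, hq, div_mul_eq_mul_div, le_div_iff₀ (by positivity)]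
          nlinarith [mul_nonneg hk (mul_nonneg (by linarith : (0 : ℝ) ≤ n)
            (by linarith : (0 : ℝ) ≤ n - 1))]
      _ = Real.exp (-2) ^ ((Fin.rev j : ℕ) + 1) := by
          rw [← Real.exp_nat_mul]; ring_nf
      _ ≤ (1 / 5) ^ ((Fin.rev j : ℕ) + 1) := pow_le_pow_left₀ (Real.exp_pos _).le hexp _
  have hgeom : ∀ m : ℕ, ∑ i ∈ range m, (1 / 5 : ℝ) ^ (i + 1) = 1 / 4 - 1 / 4 * (1 / 5) ^ m := by
    intro m
    induction m with
    | zero => simp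
    | succ m ih => rw [sum_range_succ, ih]; ring
  calc _ ≤ ∑ j : Fin n, (1 / 5 : ℝ) ^ ((Fin.rev j : ℕ) + 1) := sum_le_sum fun j _ => hterm j
    _ = ∑ j : Fin n, (1 / 5 : ℝ) ^ ((j : ℕ) + 1) :=
        Equiv.sum_comp Fin.revPerm fun j : Fin n => (1 / 5 : ℝ) ^ ((j : ℕ) + 1)
    _ = 1 / 4 - 1 / 4 * (1 / 5) ^ n := by
        rw [Fin.sum_univ_eq_sum_range fun i => (1 / 5 : ℝ) ^ (i + 1), hgeom]
    _ ≤ 1 / 4 := by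
        have : (0 : ℝ) ≤ 1 / 4 * (1 / 5) ^ n := by positivity
        linarith

/-- Example (d): the move-to-front scheme with `p_j = 2(n+1−j)/(n(n+1))` has mixing
time `Θ(n²)` (for any stationary distribution `π`, which is unique).  In 0-based card
indexing, card `j : Fin n` is the paper's card `j+1`, so `p_j = 2(n−j)/(n(n+1))`. -/
theorem mtf_linear_mixing :
    ∃ c₁ > (0 : ℝ), ∃ c₂ > (0 : ℝ), ∃ N : ℕ, ∀ n ≥ N,
      ∀ π : Equiv.Perm (Fin n) → ℝ,
        (∀ s, 0 ≤ π s) → (∑ s, π s = 1) →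
        (∀ s', ∑ s, π s *
          mtfP n (fun j => 2 * ((n : ℝ) - (j : ℕ)) / ((n : ℝ) * ((n : ℝ) + 1))) s s'
            = π s') →
        c₁ * (n : ℝ) ^ 2
            ≤ (mixTime
                (mtfP n (fun j => 2 * ((n : ℝ) - (j : ℕ)) / ((n : ℝ) * ((n : ℝ) + 1))))
                π : ℝ) ∧
        (mixTime
            (mtfP n (fun j => 2 * ((n : ℝ) - (j : ℕ)) / ((n : ℝ) * ((n : ℝ) + 1))))
            π : ℝ)
          ≤ c₂ * (n : ℝ) ^ 2 := by
  refine ⟨1 / 10, by norm_num, 2, by norm_num, 2, fun n hn π hπ₀ hπ₁ hπ => ?_⟩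
  have hn₀ : n ≠ 0 := by omega
  have hn₂ : (2 : ℝ) ≤ n := by exact_mod_cast hn
  set p : Fin n → ℝ := fun j => 2 * ((n : ℝ) - (j : ℕ)) / ((n : ℝ) * ((n : ℝ) + 1)) with hp
  have hp₀ : ∀ j, 0 ≤ p j := mtf_linear_nonneg n
  have hp₁ : ∑ j, p j = 1 := sum_mtf_linear hn₀
  have hmem : ∀ s₀, 2 * n ^ 2 ∈ {t : ℕ | tvDist (evolve (mtfP n p) (dirac s₀) t) π ≤ 1 / 4} :=
    fun s₀ => (tvDist_evolve_mtfP_le hp₀ hp₁ hπ₀ hπ₁ hπ s₀ _).trans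
      (sum_one_sub_mtf_linear_pow_le hn₀)
  constructor
  · let a : Fin n := ⟨n - 1, by omega⟩
    let b : Fin n := ⟨n - 2, by omega⟩
    have hab : a ≠ b := by simp only [a, b, ne_eq, Fin.mk.injEq]; omega
    have hpa : p a = 2 / (n * (n + 1)) := by
      simp only [hp, a]
      rw [Nat.cast_sub (by omega)]
      push_cast; ring
    have hpb : p b = 2 * (2 / (n * (n + 1))) := by
      simp only [hp, b]
      rw [Nat.cast_sub (by omega)]
      push_cast; ring
    have hr : (0 : ℝ) < 2 / (n * (n + 1)) := by positivity
    have hratio : p a / (p a + p b) = 1 / 3 := by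
      rw [hpa, hpb]; field_simp; norm_num
    have hpos : 0 < p a + p b := by rw [hpa, hpb]; linarith
    have hs₀ : Equiv.swap a b a < Equiv.swap a b b := by
      rw [Equiv.swap_apply_left, Equiv.swap_apply_right, Fin.lt_def]
      simp only [a, b]; omega
    set T := sInf {t : ℕ | tvDist (evolve (mtfP n p) (dirac (Equiv.swap a b)) t) π ≤ 1 / 4}
    have hTle : T ≤ mixTime (mtfP n p) π :=
      le_sup (f := fun s₀ => sInf {t : ℕ | tvDist (evolve (mtfP n p) (dirac s₀) t) π ≤ 1 / 4})
        (mem_univ (Equiv.swap a b))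
    have hTmem : tvDist (evolve (mtfP n p) (dirac (Equiv.swap a b)) T) π ≤ 1 / 4 :=
      Nat.sInf_mem ⟨_, hmem (Equiv.swap a b)⟩
    have hlow := (le_tvDist_evolve_mtfP hp₁ hπ₁ hπ hab hpos hs₀ T).trans hTmem
    have hle : p a + p b ≤ 1 := by
      rw [← hp₁, ← sum_pair hab]
      exact sum_le_sum_of_subset_of_nonneg (subset_univ _) fun j _ _ => hp₀ j
    have hbern := one_add_mul_le_pow (a := -(p a + p b)) (by linarith) T
    rw [hratio, show 1 - p a - p b = 1 + -(p a + p b) by ring] at hlow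
    have hT₁ : 5 / 8 ≤ T * (p a + p b) := by linarith
    have hT₂ : 5 / 8 * ((n : ℝ) * (n + 1)) ≤ T * 6 := by
      rw [hpa, hpb, show (T : ℝ) * (2 / (n * (n + 1)) + 2 * (2 / (n * (n + 1))))
        = T * 6 / (n * (n + 1)) by ring, le_div_iff₀ (by positivity)] at hT₁
      exact hT₁
    have hTle' : (T : ℝ) ≤ mixTime (mtfP n p) π := by exact_mod_cast hTle
    nlinarith
  · have h : mixTime (mtfP n p) π ≤ 2 * n ^ 2 := Finset.sup_le fun s₀ _ => Nat.sInf_le (hmem s₀)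
    exact_mod_cast h
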